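/- arXiv:1903.08190 — 2 statements merged into one kernel-verified Lean document; each statement's English description precedes it below -/
import Mathlib

section
/- Every cocycle c : SL_2(ℤ) → ℤ² for the matrix-multiplication action of SL_2(ℤ) on ℤ² is a coboundary: there exists ξ ∈ ℤ² such that c(g) = ξ − g·ξ for all g ∈ SL_2(ℤ). -/
abbrev SL (n : ℕ) := Matrix.SpecialLinearGroup (Fin n) ℤ

/-- every cocycle `c : SL₂(ℤ) → ℤ²` (for the matrix-multiplication action
of `SL₂(ℤ)` on `ℤ²`) is a coboundary. -/
theorem cocycle_SL2_is_coboundary (c : SL 2 → Fin 2 → ℤ)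
    (hc : ∀ g h : SL 2,
      c (g * h) = (↑g : Matrix (Fin 2) (Fin 2) ℤ).mulVec (c h) + c g) :
    ∃ ξ : Fin 2 → ℤ, ∀ g : SL 2,
      c g = ξ - (↑g : Matrix (Fin 2) (Fin 2) ℤ).mulVec ξ := by
  -- comparing `c (-g)` computed through `(-1) * g` and through `g * (-1)`
  have two_mul_c (g : SL 2) (i : Fin 2) :
      2 * c g i = c (-1) i - (↑g : Matrix (Fin 2) (Fin 2) ℤ).mulVec (c (-1)) i := by
    have h := (hc (-1) g).symm.trans ((congrArg c (by simp)).trans (hc g (-1)))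
    have hi := congrFun h i
    simp only [Matrix.SpecialLinearGroup.coe_neg, Matrix.SpecialLinearGroup.coe_one,
      Matrix.neg_mulVec, Matrix.one_mulVec, Pi.add_apply, Pi.neg_apply] at hi
    linarith
  have hT := two_mul_c ModularGroup.T 0
  have hS := two_mul_c ModularGroup.S 0
  simp [ModularGroup.coe_T, Matrix.mulVec, dotProduct, Fin.sum_univ_two] at hT
  simp [ModularGroup.coe_S, Matrix.mulVec, dotProduct, Fin.sum_univ_two] at hS
  obtain ⟨ξ, hξ⟩ : ∃ ξ : Fin 2 → ℤ, c (-1) = (2 : ℤ) • ξ := by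
    refine ⟨fun i => c (-1) i / 2, funext fun i => ?_⟩
    fin_cases i <;> simp <;> omega
  refine ⟨ξ, fun g => funext fun i => ?_⟩
  have h := two_mul_c g i
  rw [hξ, Matrix.mulVec_smul] at h
  simp only [Pi.smul_apply, Pi.sub_apply, smul_eq_mul] at h ⊢
  linarith
end

section
/- Let n ≥ 2 and let φ ∈ Aut(F_n) be an automorphism of the free group on n generators with φ ≠ id. Then the set {ad(g) ∘ φ ∘ ad(g)⁻¹ : g ∈ F_n} ⊆ Aut(F_n) is infinite, where ad(g) denotes the inner automorphism x ↦ gxg⁻¹. In other words, Inn(F_n) is relative ICC in Aut(F_n). In particular, for every nontrivial φ ∈ Aut(F_n) the fixed subgroup Fix(φ) = {w ∈ F_n : φ(w) = w} has infinite index in F_n. -/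
/-- The subgroup of elements fixed by an automorphism. -/
def fixedSubgroup {F : Type*} [Group F] (φ : MulAut F) : Subgroup F where
  carrier := {w | φ w = w}
  one_mem' := map_one φ
  mul_mem' := by
    intro a b ha hb
    simp only [Set.mem_setOf_eq] at *
    rw [map_mul, ha, hb]
  inv_mem' := by
    intro a ha
    simp only [Set.mem_setOf_eq] at *
    rw [map_inv, ha]

/-- The center of a free group of rank at least two is trivial. -/
theorem FreeGroup.center_eq_bot {α : Type*} [Nontrivial α] :
    Subgroup.center (FreeGroup α) = ⊥ := by
  classical
  rw [eq_bot_iff]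
  intro z hz
  rw [Subgroup.mem_bot, ← FreeGroup.toWord_eq_nil_iff]
  rcases hw : z.toWord with _ | ⟨⟨a, e⟩, w⟩
  · rfl
  exfalso
  obtain ⟨c, hc⟩ := exists_ne a
  have hcomm : FreeGroup.of c * z = z * FreeGroup.of c := Subgroup.mem_center_iff.mp hz _
  have hleft : (FreeGroup.of c * z).toWord = (c, true) :: z.toWord := by
    rw [FreeGroup.toWord_mul, FreeGroup.toWord_of, List.singleton_append, FreeGroup.reduce.cons,
      FreeGroup.reduce_toWord, hw]
    simp [hc]
  have hsub := FreeGroup.toWord_mul_sublist z (FreeGroup.of c)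
  rw [← hcomm, hleft, FreeGroup.toWord_of] at hsub
  have heq := hsub.eq_of_length (by simp)
  rw [hw] at heq
  exact hc (congrArg Prod.fst (List.cons.inj heq).1)

theorem MulAut.conj_injective_of_center_eq_bot {G : Type*} [Group G]
    (h : Subgroup.center G = ⊥) : Function.Injective (MulAut.conj : G →* MulAut G) := by
  rw [injective_iff_map_eq_one]
  intro g hg
  rw [← Subgroup.mem_bot, ← h, Subgroup.mem_center_iff]
  intro x
  have hx : g * x * g⁻¹ = x := by simpa using DFunLike.congr_fun hg x
  exact (mul_inv_eq_iff_eq_mul.mp hx).symm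

theorem MulAut.conj_mul_mul_conj_inv {G : Type*} [Group G] (φ : MulAut G) (g : G) :
    MulAut.conj g * φ * (MulAut.conj g)⁻¹ = MulAut.conj (g * (φ g)⁻¹) * φ := by
  ext x
  simp [mul_assoc]

/-- In a group with unique roots and trivial center, conjugating `φ` by the inner
automorphisms of the powers of an element moved by `φ` gives pairwise distinct automorphisms. -/
theorem MulAut.injective_conj_pow_mul_mul_inv {G : Type*} [Group G] [IsMulTorsionFree G]
    (h : Subgroup.center G = ⊥) {φ : MulAut G} {x : G} (hx : φ x ≠ x) :
    Function.Injective fun k : ℕ ↦ MulAut.conj (x ^ k) * φ * (MulAut.conj (x ^ k))⁻¹ := by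
  refine Function.Injective.of_lt_imp_ne fun i j hij hf ↦ hx ?_
  simp only [MulAut.conj_mul_mul_conj_inv] at hf
  have hg := MulAut.conj_injective_of_center_eq_bot h (mul_right_cancel hf)
  obtain ⟨k, rfl⟩ := Nat.exists_eq_add_of_lt hij
  refine pow_left_injective (Nat.succ_ne_zero k) ?_
  have hsplit : x ^ i * ((φ x) ^ i)⁻¹ =
      x ^ i * (x ^ (k + 1) * ((φ x) ^ (k + 1))⁻¹) * ((φ x) ^ i)⁻¹ := by
    rw [map_pow, map_pow, add_assoc, pow_add x, pow_add (φ x), mul_inv_rev] at hg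
    rw [hg]
    simp only [mul_assoc]
  have hpow := left_eq_mul.mp (mul_right_cancel hsplit)
  exact (mul_inv_eq_one.mp hpow).symm

theorem fixedSubgroup_index_eq_zero {G : Type*} [Group G] [IsMulTorsionFree G]
    {φ : MulAut G} (hφ : φ ≠ 1) : (fixedSubgroup φ).index = 0 := by
  by_contra hindex
  refine hφ (MulEquiv.ext fun x ↦ ?_)
  obtain ⟨k, hk, -, hmem⟩ := Subgroup.exists_pow_mem_of_index_ne_zero hindex x
  have hfix : φ (x ^ k) = x ^ k := hmem
  rw [map_pow] at hfix
  exact pow_left_injective hk.ne' hfix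

/-- for `n ≥ 2`, `Inn(F_n)` is relative ICC in `Aut(F_n)`: every nontrivial
automorphism has infinitely many conjugates under inner automorphisms; in particular its
fixed subgroup has infinite index (`index = 0` encodes infinite index). -/
theorem inn_relative_ICC_in_aut_freeGroup (n : ℕ) (hn : 2 ≤ n)
    (φ : MulAut (FreeGroup (Fin n))) (hφ : φ ≠ 1) :
    {ψ : MulAut (FreeGroup (Fin n)) |
        ∃ g : FreeGroup (Fin n), ψ = MulAut.conj g * φ * (MulAut.conj g)⁻¹}.Infinite ∧
    (fixedSubgroup φ).index = 0 := by
  have : Nontrivial (Fin n) := Fin.nontrivial_iff_two_le.mpr hn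
  refine ⟨?_, fixedSubgroup_index_eq_zero hφ⟩
  obtain ⟨x, hx⟩ : ∃ x, φ x ≠ x := by
    by_contra! hfix
    exact hφ (MulEquiv.ext hfix)
  refine Set.infinite_of_injective_forall_mem
    (MulAut.injective_conj_pow_mul_mul_inv FreeGroup.center_eq_bot hx) fun k ↦ ⟨x ^ k, rfl⟩
end
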